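/- arXiv:2101.09692 — 2 statements merged into one kernel-verified Lean document; each statement's English description precedes it below -/
import Mathlib

section
/- Let X ⊆ ℝⁿ (n > 1) be an open set, let p ≥ 1, and let 0 ≤ s < n be such that n − p(n − s) ≥ 0. Let v : X → [0, ∞) be a Borel function with v ∈ L^p_loc(X). Then for 𝓗^{n − p(n−s)}-almost every x ∈ X one has lim_{r → 0⁺} r^{−s} ∫_{B(x,r)} v d𝓛ⁿ = 0, where 𝓗^t denotes the t-dimensional Hausdorff measure and 𝓛ⁿ the Lebesgue measure. -/
open MeasureTheory Topology Filter Metric Set ENNReal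

/-- If `ν (ball x r) ≥ c r ^ d` at arbitrarily small scales at each point of `S`, then the
`d`-dimensional Hausdorff measure of `S` is controlled by `ν` of any open set containing `S`. -/
theorem hausdorffMeasure_le_of_frequently_le_measure_ball {E : Type*} [MetricSpace E]
    [MeasurableSpace E] [BorelSpace E] [SecondCountableTopology E] (ν : Measure E) {d : ℝ}
    (hd : 0 ≤ d) {c : ℝ≥0∞} (hc : c ≠ 0) (hc' : c ≠ ∞) {S U : Set E} (hU : IsOpen U)
    (hSU : S ⊆ U)
    (hS : ∀ x ∈ S, ∃ᶠ r in 𝓝[>] (0 : ℝ), c * ENNReal.ofReal r ^ d ≤ ν (ball x r)) :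
    μH[d] S ≤ 10 ^ d * (ν U / c) := by
  have cover : ∀ k : ℕ, ∃ u : Set (E × ℝ), u.Countable ∧
      (∀ a ∈ u, 0 < a.2 ∧ a.2 ≤ 1 / ((k : ℝ) + 1) ∧ ball a.1 a.2 ⊆ U ∧
        c * ENNReal.ofReal a.2 ^ d ≤ ν (ball a.1 a.2)) ∧
      u.PairwiseDisjoint (fun a => ball a.1 a.2) ∧
      S ⊆ ⋃ a : u, closedBall a.1.1 (5 * a.1.2) := by
    intro k
    have hk : 0 < 1 / ((k : ℝ) + 1) := by positivity
    obtain ⟨u, hut, hdisj, hcov⟩ :=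
      Vitali.exists_disjoint_subfamily_covering_enlargement_closedBall
        {a : E × ℝ | 0 < a.2 ∧ a.2 ≤ 1 / ((k : ℝ) + 1) ∧ ball a.1 a.2 ⊆ U ∧
          c * ENNReal.ofReal a.2 ^ d ≤ ν (ball a.1 a.2)} Prod.fst Prod.snd
        (1 / ((k : ℝ) + 1)) (fun a ha => ha.2.1) 5 (by norm_num)
    have hdisj' : u.PairwiseDisjoint (fun a => ball a.1 a.2) :=
      hdisj.mono_on fun a _ => ball_subset_closedBall
    refine ⟨u, hdisj'.countable_of_isOpen (fun _ _ => isOpen_ball)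
      (fun a ha => nonempty_ball.2 (hut ha).1), fun a ha => hut ha, hdisj', fun x hx => ?_⟩
    obtain ⟨ε, hε, hεU⟩ := Metric.isOpen_iff.1 hU x (hSU hx)
    have hsmall : ∀ᶠ r in 𝓝[>] (0 : ℝ), r ∈ Ioo 0 (min ε (1 / ((k : ℝ) + 1))) :=
      Ioo_mem_nhdsGT (lt_min hε hk)
    obtain ⟨r, hr, hr0, hr1⟩ := ((hS x hx).and_eventually hsmall).exists
    obtain ⟨b, hb, hsub⟩ := hcov (x, r) ⟨hr0, (hr1.trans_le (min_le_right _ _)).le,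
      (ball_subset_ball (hr1.trans_le (min_le_left _ _)).le).trans hεU, hr⟩
    exact mem_iUnion.2 ⟨⟨b, hb⟩, hsub (mem_closedBall_self hr0.le)⟩
  choose u huc hu hdisj hcov using cover
  have := fun k => (huc k).to_subtype
  have hdiam : ∀ k (i : u k), ediam (closedBall i.1.1 (5 * i.1.2)) ≤
      10 * ENNReal.ofReal i.1.2 := by
    intro k i
    have h0 := (hu k i i.2).1
    rw [← closedEBall_ofReal (by linarith)]
    refine ediam_closedEBall_le.trans (le_of_eq ?_)
    rw [ENNReal.ofReal_mul (by norm_num), ← mul_assoc]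
    norm_num
  have hlim : Tendsto (fun k : ℕ => 10 * ENNReal.ofReal (1 / ((k : ℝ) + 1))) atTop (𝓝 0) := by
    have h := ENNReal.tendsto_ofReal (tendsto_one_div_add_atTop_nhds_zero_nat (𝕜 := ℝ))
    simpa using ENNReal.Tendsto.const_mul h (Or.inr (by norm_num : (10 : ℝ≥0∞) ≠ ∞))
  refine (Measure.hausdorffMeasure_le_liminf_tsum d S _ hlim
    (fun k (i : u k) => closedBall i.1.1 (5 * i.1.2))
    (Eventually.of_forall fun k i => (hdiam k i).trans ?_)
    (Eventually.of_forall hcov)).trans ?_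
  · gcongr
    exact (hu k i i.2).2.1
  refine (liminf_le_liminf (Eventually.of_forall fun k => ?_)).trans (liminf_const _).le
  calc ∑' i : u k, ediam (closedBall i.1.1 (5 * i.1.2)) ^ d
      ≤ ∑' i : u k, 10 ^ d * (ν (ball i.1.1 i.1.2) / c) := by
        refine ENNReal.tsum_le_tsum fun i => ?_
        refine (ENNReal.rpow_le_rpow (hdiam k i) hd).trans ?_
        rw [ENNReal.mul_rpow_of_nonneg _ _ hd]
        gcongr
        rw [ENNReal.le_div_iff_mul_le (Or.inl hc) (Or.inl hc'), mul_comm]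
        exact (hu k i i.2).2.2.2
    _ = 10 ^ d * (ν (⋃ a ∈ u k, ball a.1 a.2) / c) := by
        rw [ENNReal.tsum_mul_left, measure_biUnion (huc k) (hdisj k)
          (fun _ _ => measurableSet_ball)]
        simp only [div_eq_mul_inv, ENNReal.tsum_mul_right]
    _ ≤ 10 ^ d * (ν U / c) := by
        gcongr
        exact iUnion₂_subset fun a ha => (hu k a ha).2.2.1

/-- A finite measure on `ℝⁿ` has, at almost every point, balls of mass `o(r ^ d)` when `d < n`. -/
theorem ae_eventually_measure_ball_lt {n : ℕ} (hn : n ≠ 0)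
    (ν : Measure (EuclideanSpace ℝ (Fin n))) [IsFiniteMeasure ν] {d : ℝ} (hdn : d < n)
    {c : ℝ≥0∞} (hc : c ≠ 0) :
    ∀ᵐ x, ∀ᶠ r in 𝓝[>] (0 : ℝ), ν (ball x r) < c * ENNReal.ofReal r ^ d := by
  have : Nonempty (Fin n) := ⟨⟨0, Nat.pos_of_ne_zero hn⟩⟩
  set K := volume (ball (0 : EuclideanSpace ℝ (Fin n)) 1)
  have hK : K ≠ ∞ := measure_ball_lt_top.ne
  filter_upwards [Besicovitch.ae_tendsto_rnDeriv ν volume, Measure.rnDeriv_lt_top ν volume]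
    with x hx hfin
  obtain ⟨M, hM, hM'⟩ := exists_between hfin
  have hpow : Tendsto (fun r : ℝ => ENNReal.ofReal r ^ ((n : ℝ) - d) * (M * K)) (𝓝[>] 0)
      (𝓝 0) := by
    have h0 : Tendsto (fun r : ℝ => ENNReal.ofReal r) (𝓝[>] 0) (𝓝 0) := by
      simpa using (ENNReal.continuous_ofReal.tendsto 0).mono_left nhdsWithin_le_nhds
    have h1 := h0.ennrpow_const ((n : ℝ) - d)
    rw [ENNReal.zero_rpow_of_pos (by linarith)] at h1
    simpa using ENNReal.Tendsto.mul_const h1 (Or.inr (ENNReal.mul_ne_top hM'.ne hK))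
  filter_upwards [hx.eventually_lt_const hM, hpow.eventually_lt_const (pos_iff_ne_zero.2 hc),
    self_mem_nhdsWithin] with r hr hrc (hr0 : 0 < r)
  have hR0 : ENNReal.ofReal r ≠ 0 := by simpa using hr0
  have hvol : volume (closedBall x r) = ENNReal.ofReal r ^ (n : ℝ) * K := by
    rw [Measure.addHaar_closedBall _ _ hr0.le, finrank_euclideanSpace_fin,
      ENNReal.ofReal_pow hr0.le, ENNReal.rpow_natCast]
  calc ν (ball x r) ≤ ν (closedBall x r) := measure_mono ball_subset_closedBall
    _ ≤ M * volume (closedBall x r) :=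
        (ENNReal.div_le_iff (measure_closedBall_pos _ _ hr0).ne'
          measure_closedBall_lt_top.ne).1 hr.le
    _ = ENNReal.ofReal r ^ ((n : ℝ) - d) * (M * K) * ENNReal.ofReal r ^ d := by
        rw [hvol, show (n : ℝ) = ((n : ℝ) - d) + d by ring,
          ENNReal.rpow_add _ _ hR0 ENNReal.ofReal_ne_top]
        ring_nf
    _ < c * ENNReal.ofReal r ^ d := by
        refine ENNReal.mul_lt_mul_left ?_ ?_ hrc
        · simp [ENNReal.rpow_eq_zero_iff, hr0, ENNReal.ofReal_ne_top]
        · simp [ENNReal.rpow_eq_top_iff, hr0, ENNReal.ofReal_ne_top]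

/-- A finite absolutely continuous measure on `ℝⁿ` has vanishing `d`-dimensional density
`μH[d]`-almost everywhere, for `0 ≤ d < n`. -/
theorem ae_hausdorffMeasure_tendsto_measure_ball_div {n : ℕ} (hn : n ≠ 0)
    (ν : Measure (EuclideanSpace ℝ (Fin n))) [IsFiniteMeasure ν] (hν : ν ≪ volume) {d : ℝ}
    (hd : 0 ≤ d) (hdn : d < n) :
    ∀ᵐ x ∂(μH[d] : Measure (EuclideanSpace ℝ (Fin n))),
      Tendsto (fun r : ℝ => ν (ball x r) / ENNReal.ofReal r ^ d) (𝓝[>] 0) (𝓝 0) := by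
  have key : ∀ k : ℕ, ∀ᵐ x ∂(μH[d] : Measure (EuclideanSpace ℝ (Fin n))),
      ∀ᶠ r in 𝓝[>] (0 : ℝ), ν (ball x r) < ((k : ℝ≥0∞) + 1)⁻¹ * ENNReal.ofReal r ^ d := by
    intro k
    have hc : ((k : ℝ≥0∞) + 1)⁻¹ ≠ 0 := by
      simp [ENNReal.inv_eq_zero]
    have hc' : ((k : ℝ≥0∞) + 1)⁻¹ ≠ ∞ := by simp
    generalize ((k : ℝ≥0∞) + 1)⁻¹ = c at hc hc'
    have hnull : ∀ᵐ x ∂ν, ∀ᶠ r in 𝓝[>] (0 : ℝ), ν (ball x r) < c * ENNReal.ofReal r ^ d :=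
      hν.ae_le (ae_eventually_measure_ball_lt hn ν hdn hc)
    rw [ae_iff] at hnull ⊢
    set S := {x | ¬∀ᶠ r in 𝓝[>] (0 : ℝ), ν (ball x r) < c * ENNReal.ofReal r ^ d}
    have hS : ∀ x ∈ S, ∃ᶠ r in 𝓝[>] (0 : ℝ), c * ENNReal.ofReal r ^ d ≤ ν (ball x r) :=
      fun x hx => by simpa [S, not_eventually] using hx
    have hA : (10 : ℝ≥0∞) ^ d * c⁻¹ ≠ ∞ :=
      ENNReal.mul_ne_top (ENNReal.rpow_ne_top_of_nonneg hd (by norm_num)) (by simpa using hc)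
    have hA0 : (10 : ℝ≥0∞) ^ d * c⁻¹ ≠ 0 :=
      mul_ne_zero (by simp [ENNReal.rpow_eq_zero_iff]) (by simpa using hc')
    refine le_antisymm (le_of_forall_gt fun ε hε => ?_) bot_le
    obtain ⟨U, hSU, hU, hUε⟩ := Set.exists_isOpen_lt_of_lt S (ε / (10 ^ d * c⁻¹))
      (by rw [hnull]; exact ENNReal.div_pos hε.ne' hA)
    refine (hausdorffMeasure_le_of_frequently_le_measure_ball ν hd hc hc' hU hSU hS).trans_lt ?_
    rw [ENNReal.lt_div_iff_mul_lt (Or.inl hA0) (Or.inl hA)] at hUε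
    rwa [div_eq_mul_inv, mul_left_comm]
  filter_upwards [ae_all_iff.2 key] with x hx
  rw [ENNReal.tendsto_nhds_zero]
  intro ε hε
  obtain ⟨k, hk⟩ := ENNReal.exists_inv_nat_lt hε.ne'
  filter_upwards [hx k] with r hr
  refine ENNReal.div_le_of_le_mul (hr.le.trans ?_)
  gcongr
  refine le_trans ?_ hk.le
  gcongr
  exact le_self_add

/-- Hölder's inequality on a ball, scaled by the power of the radius that makes the right-hand
side a power of a density ratio. -/
theorem rpow_mul_lintegral_ball_le {n : ℕ} {p s : ℝ} (hp : 1 ≤ p)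
    {v : EuclideanSpace ℝ (Fin n) → ℝ≥0∞} (hv : Measurable v)
    (x : EuclideanSpace ℝ (Fin n)) {r : ℝ} (hr : 0 < r) :
    ENNReal.ofReal r ^ (-s) * ∫⁻ y in ball x r, v y ≤
      ((∫⁻ y in ball x r, v y ^ p) / ENNReal.ofReal r ^ ((n : ℝ) - p * ((n : ℝ) - s))) ^ (1 / p) *
        volume (ball (0 : EuclideanSpace ℝ (Fin n)) 1) ^ (1 - 1 / p) := by
  have hp0 : 0 < p := by linarith
  have hp1 : 0 ≤ 1 - 1 / p := by
    rw [sub_nonneg, div_le_one hp0]; exact hp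
  have hR0 : ENNReal.ofReal r ≠ 0 := by simpa using hr
  have hvol : volume (ball x r) =
      ENNReal.ofReal r ^ (n : ℝ) * volume (ball (0 : EuclideanSpace ℝ (Fin n)) 1) := by
    rw [Measure.addHaar_ball_of_pos _ _ hr, finrank_euclideanSpace_fin,
      ENNReal.ofReal_pow hr.le, ENNReal.rpow_natCast]
  have holder := eLpNorm_le_eLpNorm_mul_rpow_measure_univ (μ := volume.restrict (ball x r))
    (p := 1) (q := ENNReal.ofReal p) (f := v) (by simpa using hp) hv.aestronglyMeasurable
  rw [eLpNorm_one_eq_lintegral_enorm, eLpNorm_eq_lintegral_rpow_enorm_toReal (by simpa using hp0)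
    ENNReal.ofReal_ne_top, ENNReal.toReal_ofReal hp0.le, Measure.restrict_apply_univ, hvol,
    ENNReal.mul_rpow_of_nonneg _ _ (by simpa using hp1)] at holder
  simp only [enorm_eq_self, ENNReal.toReal_one, div_one] at holder
  rw [← ENNReal.rpow_mul] at holder
  refine (mul_le_mul_right holder _).trans (le_of_eq ?_)
  rw [ENNReal.div_rpow_of_nonneg _ _ (by positivity), ← ENNReal.rpow_mul,
    ENNReal.div_eq_inv_mul, ← ENNReal.rpow_neg]
  have hexp : -(((n : ℝ) - p * ((n : ℝ) - s)) * (1 / p)) = -s + (n : ℝ) * (1 - 1 / p) := by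
    field_simp
    ring
  rw [hexp, ENNReal.rpow_add _ _ hR0 ENNReal.ofReal_ne_top]
  ring

/-- Let `X ⊆ ℝⁿ` (`n > 1`) be open, `p ≥ 1`, `0 ≤ s < n` with
`n - p (n - s) ≥ 0`. Let `v : X → [0,∞)` be Borel with `v ∈ L^p_loc(X)` (extended by `0`
outside `X`). Then for `𝓗^{n - p(n-s)}`-a.e. `x ∈ X`,
`lim_{r → 0⁺} r^{-s} ∫_{B(x,r)} v d𝓛ⁿ = 0`. -/
theorem statement0 {n : ℕ} (hn : 1 < n) (X : Set (EuclideanSpace ℝ (Fin n))) (hX : IsOpen X)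
    (p s : ℝ) (hp : 1 ≤ p) (hs0 : 0 ≤ s) (hsn : s < n)
    (hdim : 0 ≤ (n : ℝ) - p * ((n : ℝ) - s))
    (v : EuclideanSpace ℝ (Fin n) → ℝ) (hv : Measurable v)
    (hv0 : ∀ x, 0 ≤ v x) (hvX : ∀ x ∉ X, v x = 0)
    (hloc : ∀ K : Set (EuclideanSpace ℝ (Fin n)), IsCompact K → K ⊆ X →
      IntegrableOn (fun x => v x ^ p) K volume) :
    ∀ᵐ x ∂(μH[(n : ℝ) - p * ((n : ℝ) - s)] : Measure (EuclideanSpace ℝ (Fin n))),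
      x ∈ X → Tendsto (fun r : ℝ => r ^ (-s) * ∫ y in Metric.ball x r, v y)
        (𝓝[>] 0) (𝓝 0) := by
  have hp0 : 0 < p := by linarith
  have hdn : (n : ℝ) - p * ((n : ℝ) - s) < n := by
    have : 0 < p * ((n : ℝ) - s) := mul_pos hp0 (by linarith)
    linarith
  have hw : Measurable fun y => ENNReal.ofReal (v y) := hv.ennreal_ofReal
  rw [ae_iff]
  refine measure_null_of_locally_null _ fun z hz => ?_
  have hzX : z ∈ X := (Classical.not_imp.1 hz).1
  obtain ⟨ε, hε, hεX⟩ := nhds_basis_closedBall.mem_iff.1 (hX.mem_nhds hzX)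
  set ν : Measure (EuclideanSpace ℝ (Fin n)) :=
    (volume.restrict (ball z ε)).withDensity (fun y => ENNReal.ofReal (v y) ^ p) with hν
  have hfin : ∫⁻ y in ball z ε, ENNReal.ofReal (v y) ^ p ≠ ∞ := by
    have h := ((hloc _ (isCompact_closedBall z ε) hεX).mono_set
      ball_subset_closedBall).lintegral_lt_top
    simp_rw [fun y => ENNReal.ofReal_rpow_of_nonneg (hv0 y) hp0.le]
    exact h.ne
  have : IsFiniteMeasure ν := isFiniteMeasure_withDensity hfin
  have hac : ν ≪ volume :=
    (withDensity_absolutelyContinuous _ _).trans Measure.restrict_le_self.absolutelyContinuous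
  have hae := ae_hausdorffMeasure_tendsto_measure_ball_div (by omega : n ≠ 0) ν hac hdim hdn
  refine ⟨_ ∩ ball z ε, inter_mem self_mem_nhdsWithin
    (mem_nhdsWithin_of_mem_nhds (ball_mem_nhds z hε)), measure_mono_null ?_ (ae_iff.1 hae)⟩
  rintro x ⟨hx, hxz⟩ hlim
  refine hx fun _ => ?_
  set K := volume (ball (0 : EuclideanSpace ℝ (Fin n)) 1)
  have hbound : Tendsto (fun r : ℝ => (ν (ball x r) /
      ENNReal.ofReal r ^ ((n : ℝ) - p * ((n : ℝ) - s))) ^ (1 / p) * K ^ (1 - 1 / p))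
      (𝓝[>] 0) (𝓝 0) := by
    have h1 := hlim.ennrpow_const (1 / p)
    rw [ENNReal.zero_rpow_of_pos (by positivity)] at h1
    have hK : K ^ (1 - 1 / p) ≠ ∞ := ENNReal.rpow_ne_top_of_nonneg
      (by rw [sub_nonneg, div_le_one hp0]; exact hp) measure_ball_lt_top.ne
    simpa using ENNReal.Tendsto.mul_const h1 (Or.inr hK)
  obtain ⟨δ, hδ, hδz⟩ := Metric.isOpen_iff.1 isOpen_ball x hxz
  have hupper : ∀ᶠ r in 𝓝[>] (0 : ℝ),
      ENNReal.ofReal r ^ (-s) * ∫⁻ y in ball x r, ENNReal.ofReal (v y) ≤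
        (ν (ball x r) / ENNReal.ofReal r ^ ((n : ℝ) - p * ((n : ℝ) - s))) ^ (1 / p) *
          K ^ (1 - 1 / p) := by
    filter_upwards [Ioo_mem_nhdsGT hδ] with r hr
    have hνr : ν (ball x r) = ∫⁻ y in ball x r, ENNReal.ofReal (v y) ^ p := by
      rw [hν, withDensity_apply _ measurableSet_ball, Measure.restrict_restrict measurableSet_ball,
        inter_eq_left.2 ((ball_subset_ball hr.2.le).trans hδz)]
    rw [hνr]
    exact rpow_mul_lintegral_ball_le hp hw x hr.1
  have hzero := tendsto_of_tendsto_of_tendsto_of_le_of_le' tendsto_const_nhds hbound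
    (Eventually.of_forall fun _ => bot_le) hupper
  have hreal := (ENNReal.tendsto_toReal ENNReal.zero_ne_top).comp hzero
  refine (hreal.congr' ?_)
  filter_upwards [self_mem_nhdsWithin] with r (hr : 0 < r)
  rw [Function.comp_apply, ENNReal.toReal_mul, ← ENNReal.toReal_rpow,
    ENNReal.toReal_ofReal hr.le,
    integral_eq_lintegral_of_nonneg_ae (Eventually.of_forall hv0) hv.aestronglyMeasurable]
end

section
/- Let n > 1, R > 0, 0 < r ≤ R/8, 0 < L ≤ 1/2, 0 < ε ≤ 1/2. Let e ∈ 𝐒^{n−1} and let f : e^⊥ → ℝ be an L-Lipschitz function with |f| ≤ εR everywhere. Writing points of ℝⁿ as y' + y_n e with y' ∈ e^⊥, let x = x' + f(x') e be a point on the graph of f with R < |x| < R + r. Then there exists t ≥ 1 such that the point y := t x' + f(t x') e satisfies R + r < |y| < R + 7r and |x − y| < 9r. -/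
open Metric Set RealInnerProductSpace

/-- Pythagoras for the decomposition of a vector along a unit vector `e` and its orthogonal
complement. -/
theorem norm_add_smul_sq_of_mem_orthogonal {E : Type*} [NormedAddCommGroup E]
    [InnerProductSpace ℝ E] {e : E} (he : ‖e‖ = 1) (z : ((ℝ ∙ e)ᗮ : Submodule ℝ E)) (c : ℝ) :
    ‖(z : E) + c • e‖ ^ 2 = ‖z‖ ^ 2 + c ^ 2 := by
  have hz : inner ℝ (z : E) e = 0 := Submodule.mem_orthogonal_singleton_iff_inner_left.mp z.2
  rw [norm_add_sq_real, inner_smul_right, hz, norm_smul, he]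
  simp

/-- Let `n > 1`, `R > 0`, `0 < r ≤ R/8`, `0 < L ≤ 1/2`, `0 < ε ≤ 1/2`.
Let `e` be a unit vector and `f : e^⊥ → ℝ` an `L`-Lipschitz function with `|f| ≤ εR`.
Let `x = x' + f(x') e` (with `x' ∈ e^⊥`) be a point of the graph of `f` with
`R < |x| < R + r`. Then there exists `t ≥ 1` such that `y := t x' + f(t x') e` satisfies
`R + r < |y| < R + 7r` and `|x − y| < 9r`. -/
theorem statement3 {n : ℕ} (hn : 1 < n) (R r L ε : ℝ) (hR : 0 < R)
    (hr : 0 < r) (hrR : r ≤ R / 8) (hL : 0 < L) (hL2 : L ≤ 1 / 2)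
    (hε : 0 < ε) (hε2 : ε ≤ 1 / 2)
    (e : EuclideanSpace ℝ (Fin n)) (he : ‖e‖ = 1)
    (f : ((ℝ ∙ e)ᗮ : Submodule ℝ (EuclideanSpace ℝ (Fin n))) → ℝ)
    (hf : LipschitzWith (Real.toNNReal L) f) (hfb : ∀ z, |f z| ≤ ε * R)
    (x' : ((ℝ ∙ e)ᗮ : Submodule ℝ (EuclideanSpace ℝ (Fin n))))
    (hx₁ : R < ‖(x' : EuclideanSpace ℝ (Fin n)) + f x' • e‖)
    (hx₂ : ‖(x' : EuclideanSpace ℝ (Fin n)) + f x' • e‖ < R + r) :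
    ∃ t : ℝ, 1 ≤ t ∧
      R + r < ‖((t • x' : ((ℝ ∙ e)ᗮ : Submodule ℝ (EuclideanSpace ℝ (Fin n)))) :
          EuclideanSpace ℝ (Fin n)) + f (t • x') • e‖ ∧
      ‖((t • x' : ((ℝ ∙ e)ᗮ : Submodule ℝ (EuclideanSpace ℝ (Fin n)))) :
          EuclideanSpace ℝ (Fin n)) + f (t • x') • e‖ < R + 7 * r ∧
      ‖((x' : EuclideanSpace ℝ (Fin n)) + f x' • e) -
          (((t • x' : ((ℝ ∙ e)ᗮ : Submodule ℝ (EuclideanSpace ℝ (Fin n)))) :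
            EuclideanSpace ℝ (Fin n)) + f (t • x') • e)‖ < 9 * r := by
  set x : EuclideanSpace ℝ (Fin n) := (x' : EuclideanSpace ℝ (Fin n)) + f x' • e with hx
  have hxsq : ‖x‖ ^ 2 = ‖x'‖ ^ 2 + f x' ^ 2 := norm_add_smul_sq_of_mem_orthogonal he x' (f x')
  have hb : |f x'| ≤ R / 2 := (hfb x').trans (by nlinarith)
  have hbsq : f x' ^ 2 ≤ (R / 2) ^ 2 := sq_le_sq' (abs_le.mp hb).1 (abs_le.mp hb).2
  have ha : 3 / 4 * R < ‖x'‖ := lt_of_pow_lt_pow_left₀ 2 (norm_nonneg _) (by nlinarith)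
  have ha₀ : 0 < ‖x'‖ := by linarith
  set t : ℝ := 1 + 4 * r / ‖x'‖ with ht
  have ht₁ : 1 ≤ t := le_add_of_nonneg_right (by positivity)
  have hdist : ‖t • x' - x'‖ = 4 * r := by
    have h : t • x' - x' = (4 * r / ‖x'‖) • x' := by rw [ht]; module
    rw [h, norm_smul, Real.norm_of_nonneg (by positivity)]
    field_simp
  have htx : ‖t • x'‖ = ‖x'‖ + 4 * r := by
    rw [norm_smul, Real.norm_of_nonneg (by linarith), ht]
    field_simp
  have hδ : |f (t • x') - f x'| ≤ 2 * r := by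
    have h := hf.dist_le_mul (t • x') x'
    rw [Real.dist_eq, dist_eq_norm, hdist, Real.coe_toNNReal L hL.le] at h
    nlinarith
  set y : EuclideanSpace ℝ (Fin n) :=
    ((t • x' : ((ℝ ∙ e)ᗮ : Submodule ℝ (EuclideanSpace ℝ (Fin n)))) :
      EuclideanSpace ℝ (Fin n)) + f (t • x') • e with hy
  have hysq : ‖y‖ ^ 2 = (‖x'‖ + 4 * r) ^ 2 + f (t • x') ^ 2 := by
    rw [← htx]
    exact norm_add_smul_sq_of_mem_orthogonal he (t • x') (f (t • x'))
  have hxy : ‖x - y‖ ≤ 5 * r := by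
    have h : y - x = ((t • x' - x' : ((ℝ ∙ e)ᗮ : Submodule ℝ (EuclideanSpace ℝ (Fin n)))) :
        EuclideanSpace ℝ (Fin n)) + (f (t • x') - f x') • e := by
      rw [hx, hy, Submodule.coe_sub]
      module
    have hsq := norm_add_smul_sq_of_mem_orthogonal he (t • x' - x') (f (t • x') - f x')
    rw [← h, hdist] at hsq
    rw [norm_sub_rev]
    have hδsq := sq_le_sq' (abs_le.mp hδ).1 (abs_le.mp hδ).2
    exact (pow_le_pow_iff_left₀ (norm_nonneg _) (by positivity) two_ne_zero).mp (by nlinarith)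
  refine ⟨t, ht₁, ?_, ?_, by linarith⟩
  · have hprod : |f x' * (f (t • x') - f x')| ≤ R / 2 * (2 * r) := by
      rw [abs_mul]
      gcongr
    have hlow := (abs_le.mp hprod).1
    exact lt_of_pow_lt_pow_left₀ 2 (norm_nonneg _)
      (by nlinarith [sq_nonneg (f (t • x') - f x'), mul_pos hr hR, mul_lt_mul_of_pos_left ha hr])
  · have h := norm_sub_norm_le y x
    rw [norm_sub_rev] at h
    linarith
end
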